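/- Suppose the state space is X = X_1 × ⋯ × X_d and that for each i = 1, …, d, f_i(x_i, y_i | y_{[i-1]}, x^{[i+1]}) is a Markov transition density on X_i (a probability density in y_i with respect to the reference measure μ_i, for each value of the conditioning variables). Define the composition transition density f_comp(x, y) = ∏_{i=1}^d f_i(x_i, y_i | y_{[i-1]}, x^{[i+1]}). Suppose there exist positive constants ε_1, …, ε_d and positive measurable functions q_i on X_1 × ⋯ × X_i such that f_i(x_i, y_i | y_{[i-1]}, x^{[i+1]}) ≥ ε_i q_i(y_{[i]}) for all x^{[i]} and y_{[i]} and each i = 1, …, d. Then for every x ∈ X and every measurable A ⊆ X, P_comp(x, A) := ∫_A f_comp(x, y) μ(dy) ≥ ε_1 ⋯ ε_d ∫_A q_1(y_{[1]}) q_2(y_{[2]}) ⋯ q_d(y_{[d]}) μ(dy). Consequently, with C = ∫_X q_1(y_{[1]}) ⋯ q_d(y_{[d]}) μ(dy) and Q(A) = C^{-1} ∫_A q_1(y_{[1]}) ⋯ q_d(y_{[d]}) μ(dy), the one-step minorization P_comp(x, A) ≥ C ε_1 ⋯ ε_d Q(A) holds for all x and A, so the Markov chain corresponding to f_comp is uniformly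 ergodic with total variation distance to stationarity after n iterations bounded above by (1 − C ε_1 ⋯ ε_d)^n. -/

import Mathlib

open MeasureTheory ProbabilityTheory
open scoped ENNReal

/-- The `n`-step Markov transition kernel, obtained by iterated composition of `P`. -/
noncomputable def kIter {X : Type*} [MeasurableSpace X] (P : Kernel X X) : ℕ → Kernel X X
  | 0 => Kernel.id
  | n + 1 => (kIter P n) ∘ₖ P

/-- A uniform minorization `ν ≤ P x` contracts the oscillation of `x ↦ Pⁿ(x, A)` by the factor
`1 - ν(X)` at each step. -/
theorem kIter_apply_le_add_of_minorization {X : Type*} [MeasurableSpace X]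
    (P : Kernel X X) [IsMarkovKernel P] (ν : Measure X) [IsFiniteMeasure ν]
    (hν : ∀ x, ν ≤ P x) {A : Set X} (hA : MeasurableSet A) (n : ℕ) (x x' : X) :
    kIter P n x A ≤ kIter P n x' A + (1 - ν Set.univ) ^ n := by
  induction n generalizing x x' with
  | zero =>
    simp only [kIter, pow_zero]
    exact prob_le_one.trans le_add_self
  | succ n ih =>
    set h : X → ℝ≥0∞ := fun z => kIter P n z A
    set m : ℝ≥0∞ := ⨅ z, h z
    have hle (z : X) : h z ≤ m + (1 - ν Set.univ) ^ n := by
      rw [ENNReal.iInf_add]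
      exact le_iInf fun z' => ih z z'
    have hmass (z : X) : (P z - ν) Set.univ = 1 - ν Set.univ := by
      rw [Measure.sub_apply MeasurableSet.univ (hν z), measure_univ]
    have hsplit (z : X) :
        kIter P (n + 1) z A = ∫⁻ w, h w ∂(P z - ν) + ∫⁻ w, h w ∂ν := by
      rw [kIter, Kernel.comp_apply' _ _ _ hA, ← lintegral_add_measure,
        Measure.sub_add_cancel_of_le (hν z)]
    have hupper : ∫⁻ w, h w ∂(P x - ν) ≤
        m * (1 - ν Set.univ) + (1 - ν Set.univ) ^ (n + 1) := by
      calc ∫⁻ w, h w ∂(P x - ν) ≤ ∫⁻ _, m + (1 - ν Set.univ) ^ n ∂(P x - ν) :=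
            lintegral_mono hle
        _ = _ := by rw [lintegral_const, hmass, add_mul, pow_succ]
    have hlower : m * (1 - ν Set.univ) ≤ ∫⁻ w, h w ∂(P x' - ν) := by
      calc m * (1 - ν Set.univ) = ∫⁻ _, m ∂(P x' - ν) := by rw [lintegral_const, hmass]
        _ ≤ _ := lintegral_mono fun z => iInf_le h z
    rw [hsplit x, hsplit x', add_right_comm]
    gcongr
    exact hupper.trans (by gcongr)

theorem invariant_kIter {X : Type*} [MeasurableSpace X] {P : Kernel X X} {π : Measure X}
    (hinv : Kernel.Invariant P π) (n : ℕ) : Kernel.Invariant (kIter P n) π := by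
  induction n with
  | zero => exact Measure.bind_dirac
  | succ n ih => exact ih.comp hinv

instance isMarkovKernel_kIter {X : Type*} [MeasurableSpace X] (P : Kernel X X)
    [IsMarkovKernel P] (n : ℕ) : IsMarkovKernel (kIter P n) := by
  induction n with
  | zero => exact inferInstanceAs (IsMarkovKernel Kernel.id)
  | succ n ih => exact inferInstanceAs (IsMarkovKernel (kIter P n ∘ₖ P))

/-- Doeblin's theorem: a chain with a uniform minorization `ν ≤ P x` converges geometrically to
any invariant probability measure, uniformly in the starting point. -/
theorem abs_kIter_sub_invariant_le_of_minorization {X : Type*} [MeasurableSpace X]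
    (P : Kernel X X) [IsMarkovKernel P] (ν : Measure X) (hν : ∀ x, ν ≤ P x)
    (π : Measure X) [IsProbabilityMeasure π] (hinv : Kernel.Invariant P π)
    (n : ℕ) (x : X) {A : Set X} (hA : MeasurableSet A) :
    |(kIter P n x A).toReal - (π A).toReal| ≤ (1 - (ν Set.univ).toReal) ^ n := by
  have hν_le : ν Set.univ ≤ 1 := (hν x Set.univ).trans prob_le_one
  have : IsFiniteMeasure ν := ⟨hν_le.trans_lt ENNReal.one_lt_top⟩
  have hosc := kIter_apply_le_add_of_minorization P ν hν hA n
  have hπ : ∫⁻ z, kIter P n z A ∂π = π A := by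
    conv_rhs => rw [← invariant_kIter hinv n]
    exact (Measure.bind_apply hA (kIter P n).aemeasurable).symm
  set δ : ℝ≥0∞ := (1 - ν Set.univ) ^ n with hδ
  have hδ_top : δ ≠ ∞ := ENNReal.pow_ne_top (ENNReal.sub_ne_top ENNReal.one_ne_top)
  have hδ_real : (1 - (ν Set.univ).toReal) ^ n = δ.toReal := by
    rw [hδ, ENNReal.toReal_pow, ENNReal.toReal_sub_of_le hν_le ENNReal.one_ne_top,
      ENNReal.toReal_one]
  have hupper : kIter P n x A ≤ π A + δ := by
    calc kIter P n x A = ∫⁻ _, kIter P n x A ∂π := by simp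
      _ ≤ ∫⁻ z, kIter P n z A + δ ∂π := lintegral_mono fun z => hosc x z
      _ = π A + δ := by rw [lintegral_add_right _ measurable_const, hπ]; simp
  have hlower : π A ≤ kIter P n x A + δ := by
    calc π A = ∫⁻ z, kIter P n z A ∂π := hπ.symm
      _ ≤ ∫⁻ _, kIter P n x A + δ ∂π := lintegral_mono fun z => hosc z x
      _ = _ := by simp
  have hx_top := measure_ne_top (kIter P n x) A
  have hπ_top := measure_ne_top π A
  have hupper' := ENNReal.toReal_mono (ENNReal.add_ne_top.2 ⟨hπ_top, hδ_top⟩) hupper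
  have hlower' := ENNReal.toReal_mono (ENNReal.add_ne_top.2 ⟨hx_top, hδ_top⟩) hlower
  rw [ENNReal.toReal_add hπ_top hδ_top] at hupper'
  rw [ENNReal.toReal_add hx_top hδ_top] at hlower'
  rw [hδ_real, abs_le]
  constructor <;> linarith

/-- Uniform ergodicity of the composition (variable-at-a-time) sampler.
Here `f i x y` stands for the Markov transition density
`f_i(x_i, y_i | y_{[i-1]}, x^{[i+1]})` of the `i`-th component update: it is a probability
density in `y_i` and depends only on the coordinates `x_j` for `j ≥ i` and `y_j` for `j ≤ i`.
The composition density is `f_comp(x,y) = ∏ i, f i x y`.  If `f i x y ≥ ε i * q i y` with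
`q i` depending only on the first `i+1` coordinates, then the kernel `P` with density
`f_comp` (with respect to the product measure `μ`) satisfies
`P(x, A) ≥ (∏ ε) * ∫_A ∏ q dμ`, so with `C = ∫ ∏ q dμ` the chain is uniformly ergodic with
total variation distance to any invariant probability measure `π` after `n` steps bounded
by `(1 - C ε₁ ⋯ ε_d)^n`. -/
theorem composition_sampler_uniformly_ergodic
    {d : ℕ} {X : Fin d → Type*} [∀ j, MeasurableSpace (X j)]
    (μ₀ : ∀ j, Measure (X j)) [∀ j, SigmaFinite (μ₀ j)]
    (f : Fin d → (∀ j, X j) → (∀ j, X j) → ℝ≥0∞)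
    -- `f i x y` depends only on `x_j, j ≥ i` and `y_j, j ≤ i`
    (hdep : ∀ (i : Fin d) (x x' y y' : ∀ j, X j),
      (∀ j : Fin d, (i : ℕ) ≤ (j : ℕ) → x j = x' j) →
      (∀ j : Fin d, (j : ℕ) ≤ (i : ℕ) → y j = y' j) → f i x y = f i x' y')
    -- `f i x ·` is a probability density in the `i`-th coordinate of `y`
    (hdens : ∀ (i : Fin d) (x y : ∀ j, X j),
      ∫⁻ t, f i x (Function.update y i t) ∂(μ₀ i) = 1)
    (ε : Fin d → ℝ≥0∞) (hε : ∀ i, 0 < ε i)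
    (q : Fin d → (∀ j, X j) → ℝ≥0∞) (hq : ∀ i y, 0 < q i y)
    -- `q i` depends only on the coordinates `y_j, j ≤ i`
    (hqdep : ∀ (i : Fin d) (y y' : ∀ j, X j),
      (∀ j : Fin d, (j : ℕ) ≤ (i : ℕ) → y j = y' j) → q i y = q i y')
    (hminor : ∀ (i : Fin d) (x y : ∀ j, X j), ε i * q i y ≤ f i x y)
    (P : Kernel (∀ j, X j) (∀ j, X j)) [IsMarkovKernel P]
    (hP : ∀ (x : ∀ j, X j) (A : Set (∀ j, X j)), MeasurableSet A →
      P x A = ∫⁻ y in A, ∏ i, f i x y ∂(Measure.pi μ₀))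
    (π : Measure (∀ j, X j)) [IsProbabilityMeasure π] (hinv : Kernel.Invariant P π) :
    (∀ (x : ∀ j, X j) (A : Set (∀ j, X j)), MeasurableSet A →
        (∏ i, ε i) * ∫⁻ y in A, ∏ i, q i y ∂(Measure.pi μ₀) ≤
          ∫⁻ y in A, ∏ i, f i x y ∂(Measure.pi μ₀)) ∧
    (∀ (n : ℕ) (x : ∀ j, X j) (A : Set (∀ j, X j)), MeasurableSet A →
        |(kIter P n x A).toReal - (π A).toReal| ≤
          (1 - ((∏ i, ε i) * ∫⁻ y, ∏ i, q i y ∂(Measure.pi μ₀)).toReal) ^ n) := by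
  have hmin (x : ∀ j, X j) (A : Set (∀ j, X j)) :
      (∏ i, ε i) * ∫⁻ y in A, ∏ i, q i y ∂(Measure.pi μ₀) ≤
        ∫⁻ y in A, ∏ i, f i x y ∂(Measure.pi μ₀) :=
    (lintegral_const_mul_le _ _).trans <| lintegral_mono fun y => by
      rw [← Finset.prod_mul_distrib]
      exact Finset.prod_le_prod' fun i _ => hminor i x y
  refine ⟨fun x A _ => hmin x A, fun n x A hA => ?_⟩
  set ν : Measure (∀ j, X j) :=
    (∏ i, ε i) • (Measure.pi μ₀).withDensity fun y => ∏ i, q i y with hν_def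
  have hν_apply {B : Set (∀ j, X j)} (hB : MeasurableSet B) :
      ν B = (∏ i, ε i) * ∫⁻ y in B, ∏ i, q i y ∂(Measure.pi μ₀) := by
    rw [hν_def, Measure.smul_apply, withDensity_apply _ hB, smul_eq_mul]
  have hν (z : ∀ j, X j) : ν ≤ P z := Measure.le_iff.2 fun B hB => by
    rw [hν_apply hB, hP z B hB]
    exact hmin z B
  have key := abs_kIter_sub_invariant_le_of_minorization P ν hν π hinv n x hA
  rwa [hν_apply MeasurableSet.univ, Measure.restrict_univ] at key
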